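/- arXiv:1903.07921 — 2 statements merged into one kernel-verified Lean document; each statement's English description precedes it below -/
import Mathlib

section
/- Let R and S be rings, let M be a Frobenius S-R-bimodule, and set *M = Hom_S(M,S), an R-S-bimodule. Then fdd(R) ≤ fdd(_S M) and fdd(S) ≤ fdd(_R *M); that is, for every n ≥ 0, if the flat-dominant dimension of the regular left R-module is at least n then the flat-dominant dimension of M as a left S-module is at least n, and if the flat-dominant dimension of the regular left S-module is at least n then the flat-dominant dimension of *M as a left R-module is at least n. -/
/-!
Statement 0: If `M` is a Frobenius `S`-`R`-bimodule, then `fdd(R) ≤ fdd(_S M)` and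
`fdd(S) ≤ fdd(_R *M)` where `*M = Hom_S(M, S)` with its natural left `R`-module structure.
-/

universe u
open MulOpposite
/-- The subgroup of "balanced relations" in `M ⊗[ℤ] X`, for `M` a right `R`-module and
`X` a left `R`-module.  The quotient of `M ⊗[ℤ] X` by this subgroup is the tensor product
`M ⊗_R X` over the (possibly noncommutative) ring `R`. -/
def balRel (R : Type u) [Ring R] (M : Type u) [AddCommGroup M] [Module Rᵐᵒᵖ M]
    (X : Type u) [AddCommGroup X] [Module R X] : Submodule ℤ (TensorProduct ℤ M X) :=
  Submodule.span ℤ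
    {z | ∃ (m : M) (r : R) (x : X), z = m ⊗ₜ[ℤ] (r • x) - ((op r) • m) ⊗ₜ[ℤ] x}

/-- Scalar multiplication `I ⊗[ℤ] F → F`, `i ⊗ v ↦ i • v`, for a right ideal `I` of `R`. -/
noncomputable def idealSmul (R : Type u) [Ring R] (F : Type u) [AddCommGroup F] [Module R F]
    (I : Submodule Rᵐᵒᵖ R) : TensorProduct ℤ (↥I) F →ₗ[ℤ] F :=
  TensorProduct.lift (AddMonoidHom.toIntLinearMap
    { toFun := fun i => AddMonoidHom.toIntLinearMap
        { toFun := fun v => (i : R) • v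
          map_zero' := smul_zero _
          map_add' := fun v w => smul_add _ _ _ }
      map_zero' := by ext v; simp
      map_add' := fun i j => by ext v; simp [add_smul] })

/-- A left module `F` over a (possibly noncommutative) ring `R` is flat if for every
finitely generated right ideal `I` of `R` the canonical map `I ⊗_R F → F` is injective.
Since `I ⊗_R F` is the quotient of `I ⊗[ℤ] F` by the balanced relations (all of which are
killed by `idealSmul`), this injectivity says exactly that the kernel of `idealSmul`
is contained in the subgroup of balanced relations. -/
def ModFlat (R : Type u) [Ring R] (F : Type u) [AddCommGroup F] [Module R F] : Prop :=
  ∀ I : Submodule Rᵐᵒᵖ R, I.FG →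
    LinearMap.ker (idealSmul R F I) ≤ balRel R (↥I) F

/-- `fddGE R n M` holds iff there is an exact sequence
`0 → M → I^0 → ⋯ → I^(n-1)` of left `R`-modules in which every `I^j` is both
flat and injective; i.e. the (left) flat-dominant dimension of `M` is at least `n`. -/
def fddGE (R : Type u) [Ring R] :
    ℕ → (M : Type u) → [AddCommGroup M] → [Module R M] → Prop
  | 0, _, _, _ => True
  | (n+1), M, iM, mM =>
      letI := iM; letI := mM
      ∃ (I : Type u) (_ : AddCommGroup I) (_ : Module R I),
        ModFlat R I ∧ Module.Injective R I ∧
        ∃ f : M →ₗ[R] I, Function.Injective f ∧ fddGE R n (I ⧸ LinearMap.range f)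
section FrobeniusBimodule

variable (S R M : Type u) [Ring S] [Ring R] [AddCommGroup M]
  [Module S M] [Module Rᵐᵒᵖ M] [SMulCommClass S Rᵐᵒᵖ M] [SMulCommClass Rᵐᵒᵖ S M]

/-- The right action of `r : R` on the `S`-`R`-bimodule `M`, as an `S`-linear map. -/
def ract (r : R) : M →ₗ[S] M where
  toFun m := op r • m
  map_add' _ _ := smul_add _ _ _
  map_smul' s m := smul_comm (op r) s m

/-- The left action of `s : S` on the `S`-`R`-bimodule `M`, as a right `R`-linear map. -/
def lact (s : S) : M →ₗ[Rᵐᵒᵖ] M where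
  toFun m := s • m
  map_add' _ _ := smul_add _ _ _
  map_smul' r m := smul_comm s r m

/-- Left multiplication by `r : R` on `R`, as a right `R`-linear map. -/
def mulLeft' (r : R) : R →ₗ[Rᵐᵒᵖ] R where
  toFun x := r * x
  map_add' := mul_add r
  map_smul' a x := by
    simp only [MulOpposite.smul_eq_mul_unop, RingHom.id_apply, mul_assoc]

/-- An `S`-`R`-bimodule `M` is a Frobenius bimodule if it is finitely generated projective
as a left `S`-module and as a right `R`-module, and `Hom_S(M, S) ≅ Hom_{Rᵒᵖ}(M, R)` as
`R`-`S`-bimodules.  Here `Hom_S(M, S)` is an `R`-`S`-bimodule via `(r • f • s) m = f (m r) s`,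
and `Hom_{Rᵒᵖ}(M, R)` is an `R`-`S`-bimodule via `(r • g • s) m = r * g (s • m)`; the
bimodule conditions on the additive isomorphism `e` are stated via the two compatibilities
below. -/
def IsFrobeniusBimodule : Prop :=
  Module.Finite S M ∧ Module.Projective S M ∧
  Module.Finite Rᵐᵒᵖ M ∧ Module.Projective Rᵐᵒᵖ M ∧
  ∃ e : (M →ₗ[S] S) ≃+ (M →ₗ[Rᵐᵒᵖ] R),
    (∀ (r : R) (f : M →ₗ[S] S), e (f ∘ₗ ract S R M r) = mulLeft' R r ∘ₗ e f) ∧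
    (∀ (s : S) (f : M →ₗ[S] S),
      e (LinearMap.toSpanSingleton S S s ∘ₗ f) = e f ∘ₗ lact S R M s)

variable (Y : Type u) [AddCommGroup Y] [Module S Y]

/-- `Hom_S(M, Y)` is a left `R`-module via the right action of `R` on `M`:
`(r • f) m = f (m r)`. -/
instance homLeftModule : Module R (M →ₗ[S] Y) where
  smul r f := f ∘ₗ ract S R M r
  one_smul f := by ext m; show f _ = f m; simp [ract]
  mul_smul r r' f := by ext m; show f _ = f _; simp [ract, op_mul, mul_smul]
  smul_zero r := rfl
  smul_add r f g := rfl
  add_smul r r' f := by ext m; show f _ = f _ + f _; simp [ract, op_add, add_smul, map_add]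
  zero_smul f := by ext m; show f _ = 0; simp [ract]

end FrobeniusBimodule

section EquationalFlatness

/-- A left module `X` is equationally flat if every linear relation in `X` is trivial. -/
def EquationallyFlat (R : Type u) [Ring R] (X : Type u) [AddCommGroup X] [Module R X] : Prop :=
  ∀ (ι : Type) [Fintype ι] (r : ι → R) (x : ι → X), ∑ i, r i • x i = 0 →
    ∃ (κ : Type) (_ : Fintype κ) (a : ι → κ → R) (y : κ → X),
      (∀ i, x i = ∑ j, a i j • y j) ∧ ∀ j, ∑ i, r i * a i j = 0

variable {R X : Type u} [Ring R] [AddCommGroup X] [Module R X]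

@[simp]
lemma idealSmul_tmul (I : Submodule Rᵐᵒᵖ R) (i : I) (x : X) :
    idealSmul R X I (i ⊗ₜ[ℤ] x) = (i : R) • x := rfl

/-- The vectors `(k i • y)ᵢ`, where `k` is a right relation between the `r i`, generate the
subgroup of trivial solutions of `∑ i, r i • x i = 0`. -/
def trivialSolutions {ι : Type} [Fintype ι] (r : ι → R) (X : Type u) [AddCommGroup X]
    [Module R X] : AddSubgroup (ι → X) :=
  AddSubgroup.closure {v | ∃ (k : ι → R) (y : X), ∑ i, r i * k i = 0 ∧ v = fun i => k i • y}

lemma exists_of_mem_trivialSolutions {ι : Type} [Fintype ι] {r : ι → R} {x : ι → X}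
    (hx : x ∈ trivialSolutions r X) :
    ∃ (κ : Type) (_ : Fintype κ) (a : ι → κ → R) (y : κ → X),
      (∀ i, x i = ∑ j, a i j • y j) ∧ ∀ j, ∑ i, r i * a i j = 0 := by
  induction hx using AddSubgroup.closure_induction with
  | mem v hv =>
    obtain ⟨k, y, hk, rfl⟩ := hv
    exact ⟨Unit, inferInstance, fun i _ => k i, fun _ => y, by simp, by simpa using hk⟩
  | zero => exact ⟨Empty, inferInstance, fun _ => Empty.elim, Empty.elim, by simp, by simp⟩
  | add v w _ _ hv hw =>
    obtain ⟨κ, _, a, y, h1, h2⟩ := hv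
    obtain ⟨κ', _, a', y', h1', h2'⟩ := hw
    exact ⟨κ ⊕ κ', inferInstance, fun i => Sum.elim (a i) (a' i), Sum.elim y y',
      fun i => by simp [h1, h1'], by rintro (j | j) <;> simp [h2, h2']⟩
  | neg v _ hv =>
    obtain ⟨κ, _, a, y, h1, h2⟩ := hv
    exact ⟨κ, inferInstance, a, -y, fun i => by simp [h1], h2⟩

lemma ModFlat.equationallyFlat (h : ModFlat R X) : EquationallyFlat R X := by
  classical
  intro ι _ r x hx
  apply exists_of_mem_trivialSolutions
  set I : Submodule Rᵐᵒᵖ R := Submodule.span Rᵐᵒᵖ (Set.range r) with hI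
  have hr (i : ι) : r i ∈ I := Submodule.subset_span ⟨i, rfl⟩
  have hlift (z : I) : ∃ s : ι → R, ∑ i, r i * s i = z := by
    obtain ⟨c, hc⟩ := (Submodule.mem_span_range_iff_exists_fun Rᵐᵒᵖ).1 z.2
    exact ⟨fun i => unop (c i), by simpa [MulOpposite.smul_eq_mul_unop] using hc⟩
  choose s hs using hlift
  let q : (ι → X) →+ (ι → X) ⧸ trivialSolutions r X := QuotientAddGroup.mk' _
  have hq (k k' : ι → R) (y : X) (hk : ∑ i, r i * k i = ∑ i, r i * k' i) :
      q (fun i => k i • y) = q (fun i => k' i • y) := by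
    rw [← sub_eq_zero, ← map_sub]
    refine (QuotientAddGroup.eq_zero_iff _).2 (AddSubgroup.subset_closure ⟨k - k', y, ?_, ?_⟩)
    · simp [mul_sub, hk]
    · ext i; simp [sub_smul]
  let φ : TensorProduct ℤ I X →ₗ[ℤ] (ι → X) ⧸ trivialSolutions r X :=
    TensorProduct.lift (AddMonoidHom.toIntLinearMap (AddMonoidHom.mk'
      (fun z => AddMonoidHom.toIntLinearMap (AddMonoidHom.mk'
        (fun y => q (fun i => s z i • y))
        (fun y y' => by rw [← map_add]; congr 1; ext i; simp)))
      (fun z z' => by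
        ext y
        change q _ = q _ + q _
        rw [← map_add, hq (s (z + z')) (s z + s z') y
          (by simp [mul_add, Finset.sum_add_distrib, hs])]
        congr 1; ext i; simp [add_smul])))
  have hφ (z : I) (y : X) : φ (z ⊗ₜ y) = q (fun i => s z i • y) := rfl
  have hbal : balRel R I X ≤ LinearMap.ker φ := by
    refine Submodule.span_le.2 ?_
    rintro _ ⟨z, t, y, rfl⟩
    simp only [SetLike.mem_coe, LinearMap.mem_ker, map_sub, hφ, sub_eq_zero]
    rw [hq (s (op t • z)) (fun i => s z i * t) y]
    · simp [mul_smul]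
    · simp [hs, ← mul_assoc, ← Finset.sum_mul]
  have hmem : ∑ i, (⟨r i, hr i⟩ : I) ⊗ₜ[ℤ] x i ∈ LinearMap.ker (idealSmul R X I) := by
    simpa using hx
  have hker := hbal (h I (Submodule.fg_span (Set.finite_range r)) hmem)
  rw [LinearMap.mem_ker, map_sum] at hker
  refine (QuotientAddGroup.eq_zero_iff _).1 (Eq.trans ?_ hker)
  have : x = ∑ i, fun j => (Pi.single i (1 : R) : ι → R) j • x i := by
    ext j; simp [Pi.single_apply]
  change q x = _
  conv_lhs => rw [this]
  rw [map_sum]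
  refine Finset.sum_congr rfl fun i _ => ?_
  rw [hφ]
  apply hq
  simp [hs, Pi.single_apply]

lemma EquationallyFlat.modFlat (h : EquationallyFlat R X) : ModFlat R X := by
  intro I _ z hz
  obtain ⟨n, c, x, rfl⟩ : ∃ (n : ℕ) (c : Fin n → I) (x : Fin n → X),
      z = ∑ i, c i ⊗ₜ[ℤ] x i := by
    obtain ⟨S, rfl⟩ := TensorProduct.exists_finset z
    exact ⟨S.card, fun i => (S.equivFin.symm i).1.1, fun i => (S.equivFin.symm i).1.2, by
      rw [S.equivFin.symm.sum_comp (fun i : S => i.1.1 ⊗ₜ[ℤ] i.1.2), S.sum_coe_sort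
        (fun i => i.1 ⊗ₜ[ℤ] i.2)]⟩
  obtain ⟨κ, _, a, y, h1, h2⟩ := h (Fin n) (fun i => (c i : R)) x (by simpa using hz)
  have h3 (j : κ) : ∑ i, op (a i j) • c i = 0 := by
    ext; simpa using h2 j
  have key : ∑ i, c i ⊗ₜ[ℤ] x i =
      ∑ i, ∑ j, (c i ⊗ₜ[ℤ] (a i j • y j) - (op (a i j) • c i) ⊗ₜ[ℤ] y j) := by
    simp only [Finset.sum_sub_distrib]
    rw [Finset.sum_comm (f := fun i j => (op (a i j) • c i) ⊗ₜ[ℤ] y j)]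
    simp [h1, TensorProduct.tmul_sum, ← TensorProduct.sum_tmul, h3]
  rw [key]
  exact Submodule.sum_mem _ fun i _ => Submodule.sum_mem _ fun j _ =>
    Submodule.subset_span ⟨_, _, _, rfl⟩

/-- In an equationally flat module, finite systems of linear relations are trivial. -/
lemma EquationallyFlat.exists_of_system (h : EquationallyFlat R X) {ι Λ : Type} [Fintype ι]
    (t : Finset Λ) (r : Λ → ι → R) (x : ι → X) (hx : ∀ l ∈ t, ∑ i, r l i • x i = 0) :
    ∃ (κ : Type) (_ : Fintype κ) (a : ι → κ → R) (y : κ → X),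
      (∀ i, x i = ∑ j, a i j • y j) ∧ ∀ l ∈ t, ∀ j, ∑ i, r l i * a i j = 0 := by
  classical
  induction t using Finset.induction_on with
  | empty =>
    exact ⟨ι, inferInstance, fun i j => if i = j then 1 else 0, x, by simp, by simp⟩
  | insert l t _ ih =>
    obtain ⟨κ, _, a, y, h1, h2⟩ := ih fun l hl => hx l (Finset.mem_insert_of_mem hl)
    obtain ⟨κ', _, b, z, h3, h4⟩ := h κ (fun j => ∑ i, r l i * a i j) y (by
      rw [← hx l (Finset.mem_insert_self _ _)]
      simp only [h1, Finset.sum_smul, Finset.smul_sum, mul_smul]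
      exact Finset.sum_comm)
    have h5 (l' : Λ) (j' : κ') :
        ∑ i, r l' i * ∑ j, a i j * b j j' = ∑ j, (∑ i, r l' i * a i j) * b j j' := by
      simp only [Finset.mul_sum, Finset.sum_mul, mul_assoc]
      exact Finset.sum_comm
    refine ⟨κ', inferInstance, fun i j' => ∑ j, a i j * b j j', z, fun i => ?_, ?_⟩
    · rw [h1]
      conv_lhs => simp only [h3, Finset.smul_sum]
      simp only [Finset.sum_smul, mul_smul]
      exact Finset.sum_comm
    · intro l' hl' j'
      rw [h5]
      obtain rfl | hl' := Finset.mem_insert.1 hl'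
      · exact h4 j'
      · simp [h2 l' hl']

end EquationalFlatness

section FiniteDualBasis

/-- `P` admits a finite dual basis, i.e. it is finitely generated projective. -/
def HasFiniteDualBasis (A : Type u) [Ring A] (P : Type u) [AddCommGroup P] [Module A P] : Prop :=
  ∃ (n : ℕ) (b : Fin n → P) (g : Fin n → (P →ₗ[A] A)), ∀ p, ∑ k, g k p • b k = p

variable {A P P' : Type u} [Ring A] [AddCommGroup P] [Module A P] [AddCommGroup P'] [Module A P']

lemma hasFiniteDualBasis_of_projective [Module.Finite A P] [Module.Projective A P] :
    HasFiniteDualBasis A P := by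
  obtain ⟨n, f, g, -, -, hfg⟩ := Module.Finite.exists_comp_eq_id_of_projective A P
  refine ⟨n, fun k => f (Pi.single k 1), fun k => LinearMap.proj k ∘ₗ g, fun p => ?_⟩
  conv_rhs => rw [← LinearMap.id_apply (R := A) p, ← hfg, LinearMap.comp_apply,
    ← LinearMap.sum_single_apply (fun _ => A) (g p), map_sum]
  refine Finset.sum_congr rfl fun k _ => ?_
  rw [← map_smul, ← Pi.single_smul]
  simp

lemma HasFiniteDualBasis.of_equiv (h : HasFiniteDualBasis A P) (e : P ≃ₗ[A] P') :
    HasFiniteDualBasis A P' := by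
  obtain ⟨n, b, g, hb⟩ := h
  refine ⟨n, fun k => e (b k), fun k => g k ∘ₗ e.symm, fun p => ?_⟩
  apply e.symm.injective
  simpa using hb (e.symm p)

lemma HasFiniteDualBasis.equationallyFlat (h : HasFiniteDualBasis A P) :
    EquationallyFlat A P := by
  obtain ⟨n, b, g, hb⟩ := h
  intro ι _ r x hx
  refine ⟨Fin n, inferInstance, fun i k => g k (x i), b, fun i => (hb _).symm, fun k => ?_⟩
  simpa using congrArg (g k) hx

end FiniteDualBasis

section HomFunctor

variable {S R P X : Type u} [Ring S] [Ring R] [AddCommGroup P]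
  [Module S P] [Module Rᵐᵒᵖ P] [SMulCommClass Rᵐᵒᵖ S P]
  [AddCommGroup X] [Module S X]

@[simp]
lemma homLeftModule_smul_apply (r : R) (f : P →ₗ[S] X) (p : P) : (r • f) p = f (op r • p) := rfl

/-- Postcomposition with an `S`-linear map is `R`-linear for the action of `R` on `P`. -/
def homPostcomp (R P : Type u) [Ring R] [AddCommGroup P] [Module S P] [Module Rᵐᵒᵖ P]
    [SMulCommClass Rᵐᵒᵖ S P] {Y : Type u} [AddCommGroup Y] [Module S Y]
    (f : X →ₗ[S] Y) : (P →ₗ[S] X) →ₗ[R] (P →ₗ[S] Y) where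
  toFun g := f ∘ₗ g
  map_add' g h := by ext; simp
  map_smul' r g := rfl

lemma homPostcomp_surjective (hP : HasFiniteDualBasis S P) {Y : Type u} [AddCommGroup Y]
    [Module S Y] (f : X →ₗ[S] Y) (hf : Function.Surjective f) :
    Function.Surjective (homPostcomp R P f) := by
  obtain ⟨n, b, g, hb⟩ := hP
  intro h
  choose y hy using fun k => hf (h (b k))
  refine ⟨∑ k, LinearMap.toSpanSingleton S X (y k) ∘ₗ g k, ?_⟩
  ext p
  conv_rhs => rw [← hb p]
  simp [homPostcomp, hy]

lemma equationallyFlat_hom (hP : HasFiniteDualBasis S P)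
    (hQ : EquationallyFlat R (P →ₗ[S] S)) (hX : EquationallyFlat S X) :
    EquationallyFlat R (P →ₗ[S] X) := by
  obtain ⟨n, p, q, hpq⟩ := hP
  have expand {Y : Type u} [AddCommGroup Y] [Module S Y] (f : P →ₗ[S] Y) (m : P) :
      f m = ∑ k, q k m • f (p k) := by
    conv_lhs => rw [← hpq m]
    simp
  intro ι _ r x hx
  obtain ⟨κ, _, s, y, h1, h2⟩ := hX.exists_of_system (ι := ι × Fin n) Finset.univ
    (fun l ik => q ik.2 (op (r ik.1) • p l)) (fun ik => x ik.1 (p ik.2)) (fun l _ => by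
      rw [Fintype.sum_prod_type]
      simpa [← expand] using LinearMap.congr_fun hx (p l))
  let c (i : ι) (j : κ) : P →ₗ[S] S :=
    ∑ k, LinearMap.toSpanSingleton S S (s (i, k) j) ∘ₗ q k
  have hc (i j m) : c i j m = ∑ k, q k m * s (i, k) j := by simp [c]
  have hc0 (j : κ) : ∑ i, r i • c i j = 0 := by
    ext m
    rw [expand _ m, LinearMap.zero_apply]
    refine Finset.sum_eq_zero fun l _ => ?_
    have := h2 l (Finset.mem_univ _) j
    rw [Fintype.sum_prod_type] at this
    simp [hc, this]
  choose κ' _ a q' h3 h4 using fun j => hQ ι r (fun i => c i j) (hc0 j)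
  refine ⟨Σ j, κ' j, inferInstance, fun i jh => a jh.1 i jh.2,
    fun jh => LinearMap.toSpanSingleton S X (y jh.1) ∘ₗ q' jh.1 jh.2, fun i => ?_,
    fun jh => h4 _ _⟩
  ext m
  have h5 (j : κ) : c i j m = ∑ h, q' j h (op (a j i h) • m) := by
    simpa using LinearMap.congr_fun (h3 j i) m
  rw [expand, Fintype.sum_sigma]
  simp only [fun k => h1 (i, k), LinearMap.sum_apply, homLeftModule_smul_apply,
    LinearMap.comp_apply, LinearMap.toSpanSingleton_apply, ← Finset.sum_smul, ← h5, hc,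
    Finset.smul_sum, smul_smul]
  simp only [Finset.sum_smul]
  exact Finset.sum_comm

lemma injective_hom (hP : HasFiniteDualBasis Rᵐᵒᵖ P) (hX : Module.Injective S X) :
    Module.Injective R (P →ₗ[S] X) := by
  obtain ⟨n, b, g, hb⟩ := hP
  refine Module.Baer.injective fun J f => ?_
  let Z : Submodule S P :=
    { carrier := {z | ∀ k, unop (g k z) ∈ J}
      add_mem' := fun hz hw k => by simpa using J.add_mem (hz k) (hw k)
      zero_mem' := fun k => by simp
      smul_mem' := fun s z hz k => by
        rw [← hb z, Finset.smul_sum, map_sum, Finset.unop_sum]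
        refine J.sum_mem fun l _ => ?_
        rw [← smul_comm, map_smul]
        exact J.mul_mem_left _ (hz l) }
  let φ : Z →+ X := AddMonoidHom.mk' (fun z => ∑ k, f ⟨unop (g k z), z.2 k⟩ (b k)) (by
    intro z w
    rw [← Finset.sum_add_distrib]
    refine Finset.sum_congr rfl fun k _ => ?_
    rw [← LinearMap.add_apply, ← map_add]
    congr 2
    ext
    simp)
  have hφ (z : Z) : φ z = ∑ k, f ⟨unop (g k z), z.2 k⟩ (b k) := rfl
  have hmem (p : P) (j : J) : op (j : R) • p ∈ Z := fun k => by
    simpa using J.mul_mem_left _ j.2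
  have hφmul (p : P) (j : J) : φ ⟨op (j : R) • p, hmem p j⟩ = f j p := by
    rw [hφ]
    conv_rhs => rw [← hb p, map_sum]
    refine Finset.sum_congr rfl fun k _ => ?_
    rw [← op_unop (g k p), ← homLeftModule_smul_apply (unop (g k p)) (f j), ← map_smul]
    congr 2
    ext
    simp
  have hφsmul (s : S) (z : Z) : φ (s • z) = s • φ z := by
    have : s • z = ∑ k, (⟨op (unop (g k z)) • s • b k,
        hmem (s • b k) ⟨_, z.2 k⟩⟩ : Z) := by
      ext
      conv_lhs => rw [Submodule.coe_smul, ← hb z, Finset.smul_sum]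
      rw [AddSubmonoidClass.coe_finsetSum]
      exact Finset.sum_congr rfl fun k _ => (smul_comm _ _ _).symm
    rw [this, map_sum, hφ, Finset.smul_sum]
    exact Finset.sum_congr rfl fun k _ =>
      (hφmul (s • b k) ⟨_, z.2 k⟩).trans (map_smul _ _ _)
  obtain ⟨Φ, hΦ⟩ := hX.out Z.subtype Z.subtype_injective
    ({ φ with map_smul' := hφsmul } : Z →ₗ[S] X)
  refine ⟨LinearMap.toSpanSingleton R _ Φ, fun j hj => ?_⟩
  ext p
  rw [LinearMap.toSpanSingleton_apply, homLeftModule_smul_apply, ← hφmul p ⟨j, hj⟩]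
  exact hΦ ⟨_, hmem p ⟨j, hj⟩⟩

lemma fddGE_of_equiv {N N' : Type u} [AddCommGroup N] [Module R N] [AddCommGroup N']
    [Module R N'] (e : N' ≃ₗ[R] N) {n : ℕ} (h : fddGE R n N) : fddGE R n N' := by
  cases n with
  | zero => trivial
  | succ n =>
    obtain ⟨I, _, _, hI, hI', f, hf, h⟩ := h
    refine ⟨I, _, _, hI, hI', f ∘ₗ e, hf.comp e.injective, ?_⟩
    rwa [LinearEquiv.range_comp]

theorem fddGE_hom (hS : HasFiniteDualBasis S P) (hR : HasFiniteDualBasis Rᵐᵒᵖ P)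
    (hQ : EquationallyFlat R (P →ₗ[S] S)) (n : ℕ) (N : Type u) [AddCommGroup N] [Module S N]
    (h : fddGE S n N) : fddGE R n (P →ₗ[S] N) := by
  induction n generalizing N with
  | zero => trivial
  | succ n ih =>
    obtain ⟨I, _, _, hI, hI', f, hf, h⟩ := h
    refine ⟨P →ₗ[S] I, _, _, (equationallyFlat_hom hS hQ hI.equationallyFlat).modFlat,
      injective_hom hR hI', homPostcomp R P f, fun g g' hg => ?_, ?_⟩
    · ext p
      exact hf (LinearMap.congr_fun hg p)
    · have hker : LinearMap.range (homPostcomp R P f) =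
          LinearMap.ker (homPostcomp R P (LinearMap.range f).mkQ) := by
        ext g
        constructor
        · rintro ⟨g', rfl⟩
          ext p
          exact (Submodule.Quotient.mk_eq_zero _).2 ⟨_, rfl⟩
        · intro hg
          have hmem (p : P) : g p ∈ LinearMap.range f :=
            (Submodule.Quotient.mk_eq_zero _).1 (LinearMap.congr_fun hg p)
          refine ⟨(LinearEquiv.ofInjective f hf).symm.toLinearMap ∘ₗ g.codRestrict _ hmem, ?_⟩
          ext p
          exact congrArg Subtype.val
            ((LinearEquiv.ofInjective f hf).apply_symm_apply ⟨g p, hmem p⟩)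
      rw [hker]
      exact fddGE_of_equiv (LinearMap.quotKerEquivOfSurjective _
        (homPostcomp_surjective hS _ (Submodule.mkQ_surjective _))) (ih _ h)

end HomFunctor

section FrobeniusDual

variable {S R M : Type u} [Ring S] [Ring R] [AddCommGroup M]
  [Module S M] [Module Rᵐᵒᵖ M] [SMulCommClass Rᵐᵒᵖ S M]

instance smulCommClass_hom : SMulCommClass Sᵐᵒᵖ R (M →ₗ[S] S) := ⟨fun _ _ _ => rfl⟩

lemma HasFiniteDualBasis.hom_op (h : HasFiniteDualBasis S M) :
    HasFiniteDualBasis Sᵐᵒᵖ (M →ₗ[S] S) := by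
  obtain ⟨n, p, q, hpq⟩ := h
  refine ⟨n, q, fun k =>
    { toFun := fun f => op (f (p k))
      map_add' := fun _ _ => rfl
      map_smul' := fun _ _ => rfl }, fun f => ?_⟩
  ext m
  conv_rhs => rw [← hpq m]
  simp

lemma apply_smul_of_equiv
    (e : (M →ₗ[S] S) ≃+ (M →ₗ[Rᵐᵒᵖ] R))
    (he : ∀ (r : R) (f : M →ₗ[S] S), e (f ∘ₗ ract S R M r) = mulLeft' R r ∘ₗ e f)
    (r : R) (f : M →ₗ[S] S) (m : M) : e (r • f) m = r * e f m :=
  LinearMap.congr_fun (he r f) m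

lemma exists_dualBasis_of_equiv
    (e : (M →ₗ[S] S) ≃+ (M →ₗ[Rᵐᵒᵖ] R))
    (he : ∀ (r : R) (f : M →ₗ[S] S), e (f ∘ₗ ract S R M r) = mulLeft' R r ∘ₗ e f)
    (h : HasFiniteDualBasis Rᵐᵒᵖ M) :
    ∃ (n : ℕ) (b : Fin n → M) (q : Fin n → (M →ₗ[S] S)),
      (∀ m, ∑ k, op (e (q k) m) • b k = m) ∧ ∀ f, ∑ k, e f (b k) • q k = f := by
  obtain ⟨n, b, g, hb⟩ := h
  let g' (k : Fin n) : M →ₗ[Rᵐᵒᵖ] R :=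
    { toFun := fun m => unop (g k m)
      map_add' := fun _ _ => by simp
      map_smul' := fun _ _ => by simp [MulOpposite.smul_eq_mul_unop] }
  refine ⟨n, b, fun k => e.symm (g' k), fun m => by simpa [g'] using hb m, fun f => ?_⟩
  apply e.injective
  ext m
  conv_rhs => rw [← hb m]
  simp [apply_smul_of_equiv e he, g', MulOpposite.smul_eq_mul_unop]

lemma hasFiniteDualBasis_hom
    (e : (M →ₗ[S] S) ≃+ (M →ₗ[Rᵐᵒᵖ] R))
    (he : ∀ (r : R) (f : M →ₗ[S] S), e (f ∘ₗ ract S R M r) = mulLeft' R r ∘ₗ e f)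
    (h : HasFiniteDualBasis Rᵐᵒᵖ M) :
    HasFiniteDualBasis R (M →ₗ[S] S) := by
  obtain ⟨n, b, q, -, hq⟩ := exists_dualBasis_of_equiv e he h
  exact ⟨n, q, fun k =>
    { toFun := fun f => e f (b k)
      map_add' := fun _ _ => by simp
      map_smul' := fun r f => apply_smul_of_equiv e he r f (b k) }, hq⟩

/-- A Frobenius bimodule is the `R`-dual of its `S`-dual. -/
lemma nonempty_equiv_bidual [SMulCommClass S Rᵐᵒᵖ M]
    (e : (M →ₗ[S] S) ≃+ (M →ₗ[Rᵐᵒᵖ] R))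
    (he : ∀ (r : R) (f : M →ₗ[S] S), e (f ∘ₗ ract S R M r) = mulLeft' R r ∘ₗ e f)
    (he' : ∀ (s : S) (f : M →ₗ[S] S),
      e (LinearMap.toSpanSingleton S S s ∘ₗ f) = e f ∘ₗ lact S R M s)
    (h : HasFiniteDualBasis Rᵐᵒᵖ M) : Nonempty (M ≃ₗ[S] ((M →ₗ[S] S) →ₗ[R] R)) := by
  obtain ⟨n, b, q, hb, hq⟩ := exists_dualBasis_of_equiv e he h
  let ev : M →ₗ[S] ((M →ₗ[S] S) →ₗ[R] R) :=
    { toFun := fun m =>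
        { toFun := fun f => e f m
          map_add' := fun _ _ => by simp
          map_smul' := fun r f => apply_smul_of_equiv e he r f m }
      map_add' := fun _ _ => by ext; simp
      map_smul' := fun s m => by
        ext f
        exact (LinearMap.congr_fun (he' s f) m).symm }
  have hev (m f) : ev m f = e f m := rfl
  refine ⟨LinearEquiv.ofBijective ev ⟨fun m m' hm => ?_, fun F => ?_⟩⟩
  · rw [← hb m, ← hb m']
    simp only [← hev, hm]
  · refine ⟨∑ k, op (F (q k)) • b k, ?_⟩
    ext f
    conv_rhs => rw [← hq f]
    simp [hev]

end FrobeniusDual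

theorem stmt0 (S R M : Type u) [Ring S] [Ring R] [AddCommGroup M]
    [Module S M] [Module Rᵐᵒᵖ M] [SMulCommClass S Rᵐᵒᵖ M] [SMulCommClass Rᵐᵒᵖ S M]
    (hM : IsFrobeniusBimodule S R M) :
    (∀ n : ℕ, fddGE R n R → fddGE S n M) ∧
    (∀ n : ℕ, fddGE S n S → fddGE R n (M →ₗ[S] S)) := by
  obtain ⟨_, _, _, _, e, he, he'⟩ := hM
  have hS : HasFiniteDualBasis S M := hasFiniteDualBasis_of_projective
  have hR : HasFiniteDualBasis Rᵐᵒᵖ M := hasFiniteDualBasis_of_projective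
  have hQ := hasFiniteDualBasis_hom e he hR
  obtain ⟨E⟩ := nonempty_equiv_bidual e he he' hR
  exact ⟨fun n h => fddGE_of_equiv E
      (fddGE_hom hQ hS.hom_op (hS.of_equiv E).equationallyFlat n R h),
    fun n h => fddGE_hom hS hR hQ.equationallyFlat n S h⟩
end

section
/- Let A and B be Artin algebras (algebras over a commutative artinian ring k that are finitely generated as k-modules) and let M be a Frobenius B-A-bimodule. Then domdim(A) ≤ domdim(_B M) and domdim(B) ≤ domdim(_A Hom_B(M,B)), where Hom_B(M,B) carries its natural left A-module structure coming from the right A-action on M. -/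
/-!
Statement 2: Let `A`, `B` be Artin algebras (algebras over a commutative artinian ring `k`,
finitely generated as `k`-modules) and `M` a Frobenius `B`-`A`-bimodule.  Then
`domdim(A) ≤ domdim(_B M)` and `domdim(B) ≤ domdim(_A Hom_B(M, B))`.
-/

universe u
open MulOpposite
/-- `domdimGE R n M` holds iff there is an exact sequence
`0 → M → I^0 → ⋯ → I^(n-1)` of left `R`-modules in which every `I^j` is both
projective and injective; i.e. the dominant dimension of `M` is at least `n`. -/
def domdimGE (R : Type u) [Ring R] :
    ℕ → (M : Type u) → [AddCommGroup M] → [Module R M] → Prop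
  | 0, _, _, _ => True
  | (n+1), M, iM, mM =>
      letI := iM; letI := mM
      ∃ (I : Type u) (_ : AddCommGroup I) (_ : Module R I),
        Module.Projective R I ∧ Module.Injective R I ∧
        ∃ f : M →ₗ[R] I, Function.Injective f ∧ domdimGE R n (I ⧸ LinearMap.range f)
/-- A finite dual basis `∑ i, f i m • y i = m` of a left module exhibits it as projective. -/
theorem projective_of_dualBasis {S M : Type u} [Ring S] [AddCommGroup M] [Module S M] {n : ℕ}
    (y : Fin n → M) (f : Fin n → M →ₗ[S] S) (h : ∀ m, ∑ i, f i m • y i = m) :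
    Module.Projective S M :=
  Module.Projective.of_split (LinearMap.pi f) (Fintype.linearCombination S y)
    (LinearMap.ext fun m => by simpa [Fintype.linearCombination_apply] using h m)

theorem exists_dualBasis (S M : Type u) [Ring S] [AddCommGroup M] [Module S M]
    [Module.Finite S M] [Module.Projective S M] :
    ∃ (n : ℕ) (y : Fin n → M) (f : Fin n → M →ₗ[S] S), ∀ m, ∑ i, f i m • y i = m := by
  obtain ⟨n, p, g, -, -, hpg⟩ := Module.Finite.exists_comp_eq_id_of_projective S M
  refine ⟨n, fun i => p (Pi.single i 1), fun i => LinearMap.proj i ∘ₗ g, fun m => ?_⟩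
  have h := LinearMap.congr_fun hpg m
  rw [LinearMap.comp_apply, LinearMap.id_apply] at h
  conv_rhs => rw [← h, LinearMap.pi_apply_eq_sum_univ p (g m)]
  refine Finset.sum_congr rfl fun i _ => ?_
  simp only [LinearMap.comp_apply, LinearMap.proj_apply]
  congr 2
  ext j
  simp [Pi.single_apply, eq_comm]

theorem exists_right_dualBasis (R M : Type u) [Ring R] [AddCommGroup M] [Module Rᵐᵒᵖ M]
    [Module.Finite Rᵐᵒᵖ M] [Module.Projective Rᵐᵒᵖ M] :
    ∃ (n : ℕ) (x : Fin n → M) (φ : Fin n → M →ₗ[Rᵐᵒᵖ] R), ∀ m, ∑ i, op (φ i m) • x i = m := by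
  obtain ⟨n, x, φ, h⟩ := exists_dualBasis Rᵐᵒᵖ M
  exact ⟨n, x, fun i => (opLinearEquiv Rᵐᵒᵖ : R ≃ₗ[Rᵐᵒᵖ] Rᵐᵒᵖ).symm.toLinearMap ∘ₗ φ i, h⟩

theorem domdimGE_of_equiv {R : Type u} [Ring R] {n : ℕ} {X Y : Type u} [AddCommGroup X]
    [AddCommGroup Y] [Module R X] [Module R Y] (e : X ≃ₗ[R] Y) (h : domdimGE R n X) :
    domdimGE R n Y := by
  induction n generalizing X Y with
  | zero => trivial
  | succ n ih =>
    obtain ⟨I, _, _, hp, hi, f, hf, hd⟩ := h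
    refine ⟨I, _, _, hp, hi, f ∘ₗ e.symm.toLinearMap, hf.comp e.symm.injective, ih ?_ hd⟩
    exact Submodule.quotEquivOfEq _ _ (LinearEquiv.range_comp e.symm f).symm

theorem homLeftModule_smul_apply_s2 {S R M Y : Type u} [Ring S] [Ring R] [AddCommGroup M]
    [Module S M] [Module Rᵐᵒᵖ M] [SMulCommClass Rᵐᵒᵖ S M] [AddCommGroup Y] [Module S Y] (r : R)
    (f : M →ₗ[S] Y) (m : M) : (r • f) m = f (op r • m) := rfl

section HomFunctor

variable (S R M : Type u) [Ring S] [Ring R] [AddCommGroup M]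
  [Module S M] [Module Rᵐᵒᵖ M] [SMulCommClass Rᵐᵒᵖ S M]

/-- Postcomposition with an `S`-linear map, as an `R`-linear map `Hom_S(M, Y) → Hom_S(M, Z)`. -/
def homMap {Y Z : Type u} [AddCommGroup Y] [AddCommGroup Z] [Module S Y] [Module S Z]
    (g : Y →ₗ[S] Z) : (M →ₗ[S] Y) →ₗ[R] (M →ₗ[S] Z) where
  toFun f := g ∘ₗ f
  map_add' _ _ := LinearMap.comp_add _ _ _
  map_smul' _ _ := rfl

instance homLeftModule_smulCommClass : SMulCommClass R Sᵐᵒᵖ (M →ₗ[S] S) := ⟨fun _ _ _ => rfl⟩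

instance homLeftModule_smulCommClass' : SMulCommClass Sᵐᵒᵖ R (M →ₗ[S] S) := ⟨fun _ _ _ => rfl⟩

/-- `Hom_S(M, -)` preserves projective modules when `M` has a finite dual basis on the left and
`Hom_S(M, S)` is projective. -/
theorem projective_hom {n : ℕ} (y : Fin n → M) (f : Fin n → M →ₗ[S] S)
    (hy : ∀ m, ∑ i, f i m • y i = m) [Module.Projective R (M →ₗ[S] S)]
    (Q : Type u) [AddCommGroup Q] [Module S Q] [Module.Projective S Q] :
    Module.Projective R (M →ₗ[S] Q) := by
  classical
  obtain ⟨s, hs⟩ := Module.projective_def'.1 (inferInstance : Module.Projective S Q)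
  let coords : (M →ₗ[S] Q) → Q →₀ (M →ₗ[S] S) := fun u =>
    ∑ k, (s (u (y k))).mapRange (fun b => LinearMap.toSpanSingleton S S b ∘ₗ f k) (by
      ext m
      simp)
  have hcoords : ∀ u q m, coords u q m = s (u m) q := by
    intro u q m
    conv_rhs => rw [← hy m]
    simp [coords, Finsupp.finsetSum_apply, LinearMap.sum_apply]
  let i : (M →ₗ[S] Q) →ₗ[R] (Q →₀ (M →ₗ[S] S)) :=
    { toFun := coords
      map_add' := fun u v => by
        ext q m
        simp [hcoords]
      map_smul' := fun r u => by
        ext q m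
        simp [hcoords, homLeftModule_smul_apply_s2] }
  let p : (Q →₀ (M →ₗ[S] S)) →ₗ[R] (M →ₗ[S] Q) :=
    Finsupp.lsum ℕ fun q => homMap S R M (LinearMap.toSpanSingleton S Q q)
  have : Module.Projective R (Q →₀ (M →ₗ[S] S)) :=
    Module.Projective.of_equiv (finsuppLequivDFinsupp R).symm
  refine Module.Projective.of_split i p (LinearMap.ext fun u => LinearMap.ext fun m => ?_)
  have hp : ∀ c : Q →₀ (M →ₗ[S] S), p c m = c.sum fun q g => g m • q := fun c => by
    simp only [p, Finsupp.lsum_apply, Finsupp.sum, LinearMap.sum_apply]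
    rfl
  have hsum := LinearMap.congr_fun hs (u m)
  rw [LinearMap.comp_apply, Finsupp.linearCombination_apply] at hsum
  refine (hp (coords u)).trans (Eq.trans ?_ hsum)
  rw [Finsupp.sum_of_support_subset (s := (coords u).support ∪ (s (u m)).support) _
      Finset.subset_union_left _ (by simp),
    Finsupp.sum_of_support_subset (s := (coords u).support ∪ (s (u m)).support) _
      Finset.subset_union_right _ (by simp)]
  exact Finset.sum_congr rfl fun q _ => by
    simp only [id]
    rw [← hcoords]

variable [SMulCommClass S Rᵐᵒᵖ M]

/-- `Hom_S(M, -)` preserves injective modules when `M` has a finite dual basis on the right. -/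
theorem injective_hom_s2 {n : ℕ} (x : Fin n → M) (φ : Fin n → M →ₗ[Rᵐᵒᵖ] R)
    (hx : ∀ m, ∑ i, op (φ i m) • x i = m) (I : Type u) [AddCommGroup I] [Module S I]
    (hI : Module.Injective S I) : Module.Injective R (M →ₗ[S] I) := by
  refine Module.Baer.injective fun J g => ?_
  let P : Submodule S M :=
    { carrier := {m | ∀ ψ : M →ₗ[Rᵐᵒᵖ] R, ψ m ∈ J}
      add_mem' := fun {a b} ha hb ψ => by
        rw [map_add]
        exact J.add_mem (ha ψ) (hb ψ)
      zero_mem' := fun ψ => by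
        rw [map_zero]
        exact J.zero_mem
      smul_mem' := fun s m hm ψ => hm (ψ ∘ₗ lact S R M s) }
  have hP : ∀ (m : M) (j : R), j ∈ J → op j • m ∈ P := fun m j hj ψ => by
    rw [map_smul, op_smul_eq_mul]
    exact J.mul_mem_left _ hj
  let h : P → I := fun p => ∑ i, g ⟨φ i p.1, p.2 (φ i)⟩ (x i)
  have h_add : ∀ p q, h (p + q) = h p + h q := fun p q => by
    simp only [h, ← Finset.sum_add_distrib, ← LinearMap.add_apply, ← map_add]
    refine Finset.sum_congr rfl fun i _ => ?_
    congr 2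
    exact Subtype.ext (map_add (φ i) p.1 q.1)
  let h' : P →+ I := AddMonoidHom.mk' h h_add
  have h_op : ∀ (m : M) (j : R) (hj : j ∈ J), h' ⟨op j • m, hP m j hj⟩ = g ⟨j, hj⟩ m := by
    intro m j hj
    conv_rhs => rw [← hx m, map_sum]
    change ∑ i, g ⟨φ i (op j • m), hP m j hj (φ i)⟩ (x i) = _
    refine Finset.sum_congr rfl fun i _ => ?_
    have hi : (⟨φ i (op j • m), hP m j hj (φ i)⟩ : J) = φ i m • ⟨j, hj⟩ :=
      Subtype.ext (map_smul (φ i) (op j) m)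
    rw [hi, map_smul, homLeftModule_smul_apply_s2]
  have h_smul : ∀ (s : S) (p : P), h' (s • p) = s • h' p := by
    intro s p
    have hp : s • p = ∑ i, (⟨op (φ i p.1) • (s • x i), hP _ _ (p.2 (φ i))⟩ : P) := by
      refine Subtype.ext ?_
      rw [AddSubmonoidClass.coe_finsetSum]
      conv_lhs => rw [Submodule.coe_smul, ← hx p.1, Finset.smul_sum]
      exact Finset.sum_congr rfl fun i _ => smul_comm _ _ _
    rw [hp, map_sum]
    refine Eq.trans (Finset.sum_congr rfl fun i _ => ?_) (Finset.smul_sum (r := s)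
      (f := fun i => g ⟨φ i p.1, p.2 (φ i)⟩ (x i))).symm
    exact (h_op _ _ (p.2 (φ i))).trans (map_smul (g ⟨φ i p.1, p.2 (φ i)⟩) s (x i))
  let H : P →ₗ[S] I := { h' with map_smul' := h_smul }
  obtain ⟨F, hF⟩ := hI.out P.subtype P.injective_subtype H
  refine ⟨LinearMap.toSpanSingleton R _ F, fun j hj => LinearMap.ext fun m => ?_⟩
  exact (hF ⟨op j • m, hP m j hj⟩).trans (h_op m j hj)

/-- `Hom_S(M, -)` does not decrease the dominant dimension when it is exact and preserves
projective and injective modules. -/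
theorem domdimGE_hom {n₁ n₂ : ℕ} (y : Fin n₁ → M) (f : Fin n₁ → M →ₗ[S] S)
    (hy : ∀ m, ∑ i, f i m • y i = m) (x : Fin n₂ → M) (φ : Fin n₂ → M →ₗ[Rᵐᵒᵖ] R)
    (hx : ∀ m, ∑ i, op (φ i m) • x i = m) [Module.Projective R (M →ₗ[S] S)]
    {n : ℕ} {X : Type u} [AddCommGroup X] [Module S X] (h : domdimGE S n X) :
    domdimGE R n (M →ₗ[S] X) := by
  have := projective_of_dualBasis y f hy
  induction n generalizing X with
  | zero => trivial
  | succ n ih =>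
    obtain ⟨I, _, _, hp, hi, g, hg, hd⟩ := h
    refine ⟨M →ₗ[S] I, _, homLeftModule S R M I, projective_hom S R M y f hy I,
      injective_hom_s2 S R M x φ hx I hi, homMap S R M g, ?_, domdimGE_of_equiv ?_ (ih hd)⟩
    · intro u v huv
      ext m
      exact hg (LinearMap.congr_fun huv m)
    · have hsurj : Function.Surjective (homMap S R M (LinearMap.range g).mkQ) := fun u =>
        Module.projective_lifting_property _ u (Submodule.mkQ_surjective _)
      refine ((Submodule.quotEquivOfEq _ _ ?_).trans
        (LinearMap.quotKerEquivOfSurjective _ hsurj)).symm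
      ext u
      constructor
      · rintro ⟨v, rfl⟩
        refine LinearMap.ext fun m => ?_
        exact (Submodule.Quotient.mk_eq_zero _).2 ⟨v m, rfl⟩
      · intro hu
        have hmem : ∀ m, u m ∈ LinearMap.range g := fun m =>
          (Submodule.Quotient.mk_eq_zero _).1 (LinearMap.congr_fun hu m)
        refine ⟨(LinearEquiv.ofInjective g hg).symm.toLinearMap ∘ₗ u.codRestrict _ hmem, ?_⟩
        ext m
        exact congrArg Subtype.val
          ((LinearEquiv.ofInjective g hg).apply_symm_apply (u.codRestrict _ hmem m))

end HomFunctor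

theorem stmt2 (k : Type u) [CommRing k] [IsArtinianRing k]
    (A B : Type u) [Ring A] [Ring B] [Algebra k A] [Algebra k B]
    [Module.Finite k A] [Module.Finite k B]
    (M : Type u) [AddCommGroup M]
    [Module B M] [Module Aᵐᵒᵖ M] [SMulCommClass B Aᵐᵒᵖ M] [SMulCommClass Aᵐᵒᵖ B M]
    (hM : IsFrobeniusBimodule B A M) :
    (∀ n : ℕ, domdimGE A n A → domdimGE B n M) ∧
    (∀ n : ℕ, domdimGE B n B → domdimGE A n (M →ₗ[B] B)) := by
  obtain ⟨_, _, _, _, e, he, he'⟩ := hM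
  obtain ⟨n₁, y, f, hy⟩ := exists_dualBasis B M
  obtain ⟨n₂, x, φ, hx⟩ := exists_right_dualBasis A M
  -- The left dual basis of `Hom_B(M, B)` over `A` and its right dual basis over `B`.
  let ev : M → (M →ₗ[B] B) →ₗ[A] A := fun m =>
    { toFun := fun g => e g m
      map_add' := fun g g' => by rw [map_add, LinearMap.add_apply]
      map_smul' := fun a g => LinearMap.congr_fun (he a g) m }
  have hev : ∀ g : M →ₗ[B] B, ∑ i, ev (x i) g • e.symm (φ i) = g := by
    intro g
    apply e.injective
    ext m
    have h : ∀ i, e (ev (x i) g • e.symm (φ i)) m = e g (x i) * φ i m := fun i =>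
      (LinearMap.congr_fun (he _ _) m).trans (by
        rw [e.apply_symm_apply]
        rfl)
    rw [map_sum, LinearMap.sum_apply]
    conv_rhs => rw [← hx m, map_sum]
    exact Finset.sum_congr rfl fun i _ => by rw [h, map_smul, op_smul_eq_mul]
  let evr : M → (M →ₗ[B] B) →ₗ[Bᵐᵒᵖ] B := fun m =>
    { toFun := fun g => g m
      map_add' := fun _ _ => rfl
      map_smul' := fun _ _ => rfl }
  have hevr : ∀ g : M →ₗ[B] B, ∑ i, op (evr (y i) g) • f i = g := by
    intro g
    ext m
    conv_rhs => rw [← hy m, map_sum]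
    rw [LinearMap.sum_apply]
    exact Finset.sum_congr rfl fun i _ => (map_smul g (f i m) (y i)).symm
  have := projective_of_dualBasis _ _ hev
  refine ⟨fun n h => ?_, fun n h => domdimGE_hom B A M y f hy x φ hx h⟩
  -- `M` is the dual of the `A`-`B`-bimodule `Hom_B(M, B)`.
  let toDual : M →ₗ[B] ((M →ₗ[B] B) →ₗ[A] A) :=
    { toFun := ev
      map_add' := fun m m' => LinearMap.ext fun g => map_add (e g) m m'
      map_smul' := fun b m => LinearMap.ext fun g =>
        (LinearMap.congr_fun (he' b g) m).symm }
  have hbij : Function.Bijective toDual := by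
    constructor
    · intro m m' hmm
      have h : ∀ i, φ i m = φ i m' := fun i => by
        have h := LinearMap.congr_fun hmm (e.symm (φ i))
        change e (e.symm (φ i)) m = e (e.symm (φ i)) m' at h
        rwa [e.apply_symm_apply] at h
      rw [← hx m, ← hx m']
      simp only [h]
    · intro g
      refine ⟨∑ i, op (g (e.symm (φ i))) • x i, LinearMap.ext fun u => ?_⟩
      conv_rhs => rw [← hev u, map_sum]
      change e u _ = _
      rw [map_sum]
      exact Finset.sum_congr rfl fun i _ => by
        rw [map_smul, map_smul, op_smul_eq_mul]
        rfl
  let E := LinearEquiv.ofBijective toDual hbij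
  have : Module.Projective B M := projective_of_dualBasis y f hy
  have : Module.Projective B ((M →ₗ[B] B) →ₗ[A] A) := Module.Projective.of_equiv E
  exact domdimGE_of_equiv E.symm (domdimGE_hom A B (M →ₗ[B] B) _ _ hev _ _ hevr h)
end
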